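/- If G is a critical-primitive finite simple graph with |V(G)| ≥ 6, then G contains an induced subgraph isomorphic to 𝒢₃ or to the complement of 𝒢₃. -/

import Mathlib

/-- `M` is a module of `G`. -/
def IsModule {V : Type} (G : SimpleGraph V) (M : Set V) : Prop :=
  ∀ z ∉ M, (∀ x ∈ M, G.Adj z x) ∨ (∀ x ∈ M, ¬ G.Adj z x)

/-- A graph is primitive if it has at least four vertices and all of its
modules are trivial. -/
def IsPrimitive {V : Type} (G : SimpleGraph V) : Prop :=
  4 ≤ Nat.card V ∧
    ∀ M : Set V, IsModule G M → M = ∅ ∨ (∃ x, M = {x}) ∨ M = Set.univ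

/-- A graph is critical-primitive if it is primitive and deleting any vertex
destroys primitivity. -/
def IsCriticalPrimitive {V : Type} (G : SimpleGraph V) : Prop :=
  IsPrimitive G ∧ ∀ x : V, ¬ IsPrimitive (G.induce ({x}ᶜ : Set V))

/-- The graph `𝒢_r` on vertices `a₁, …, a_r, b₁, …, b_r` whose edges are
exactly the pairs `{a_i, b_j}` with `i ≥ j`. -/
def calG (r : ℕ) : SimpleGraph (Fin r ⊕ Fin r) :=
  SimpleGraph.fromRel (fun x y =>
    ∃ i j : Fin r, j ≤ i ∧ x = Sum.inl i ∧ y = Sum.inr j)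

/-- `M` is a module of the subgraph of `G` induced by `S`. -/
def IsModuleOn {V : Type} (G : SimpleGraph V) (S M : Set V) : Prop :=
  M ⊆ S ∧ ∀ z ∈ S, z ∉ M → ∀ a ∈ M, ∀ b ∈ M, G.Adj z a → G.Adj z b

/-- All modules of the subgraph of `G` induced by `S` are trivial. -/
def PrimitiveOn {V : Type} (G : SimpleGraph V) (S : Set V) : Prop :=
  ∀ M, IsModuleOn G S M → M.Subsingleton ∨ M = S

/-- The vertex `v` does not distinguish the elements of `X`. -/
def Homogeneous {V : Type} (G : SimpleGraph V) (X : Set V) (v : V) : Prop :=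
  ∀ z ∈ X, ∀ w ∈ X, G.Adj v z → G.Adj v w

/-- The vertices `u` and `v` are not distinguished by any element of `X` other than `u`. -/
def TwinOn {V : Type} (G : SimpleGraph V) (X : Set V) (u v : V) : Prop :=
  ∀ z ∈ X, z ≠ u → (G.Adj z u ↔ G.Adj z v)

/-- `p, q, r, s` is an induced path. -/
def IsInducedP4 {V : Type} (G : SimpleGraph V) (p q r s : V) : Prop :=
  G.Adj p q ∧ G.Adj q r ∧ G.Adj r s ∧ ¬ G.Adj p r ∧ ¬ G.Adj p s ∧ ¬ G.Adj q s

section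

variable {V : Type} {G : SimpleGraph V}

theorem IsModuleOn.inter {S T M : Set V} (h : IsModuleOn G S M) (hT : T ⊆ S) :
    IsModuleOn G T (M ∩ T) :=
  ⟨Set.inter_subset_right, fun z hz hzM a ha b hb =>
    h.2 z (hT hz) (fun hm => hzM ⟨hm, hz⟩) a ha.1 b hb.1⟩

theorem PrimitiveOn.inter_cases {S X M : Set V} (hX : PrimitiveOn G X) (hXS : X ⊆ S)
    (hM : IsModuleOn G S M) :
    (∀ z ∈ X, z ∉ M) ∨ (∃ u ∈ X, u ∈ M ∧ ∀ z ∈ X, z ∈ M → z = u) ∨ (∀ z ∈ X, z ∈ M) := by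
  rcases hX _ (hM.inter hXS) with h | h
  · by_cases hu : ∃ u ∈ X, u ∈ M
    · obtain ⟨u, hu, huM⟩ := hu
      exact .inr (.inl ⟨u, hu, huM, fun z hz hzM => h ⟨hzM, hz⟩ ⟨huM, hu⟩⟩)
    · exact .inl fun z hz hzM => hu ⟨z, hz, hzM⟩
  · exact .inr (.inr fun z hz => (h.symm ▸ hz : z ∈ M ∩ X).1)

theorem PrimitiveOn.compl {S : Set V} (h : PrimitiveOn G S) : PrimitiveOn Gᶜ S := by
  intro M hM
  refine h M ⟨hM.1, fun z hz hzM a ha b hb hab => ?_⟩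
  by_contra hnb
  have h1 := hM.2 z hz hzM b hb a ha
  have h2 : z ≠ b := fun e => hzM (e ▸ hb)
  simp only [SimpleGraph.compl_adj] at h1
  exact (h1 ⟨h2, hnb⟩).2 hab

theorem primitiveOn_compl {S : Set V} : PrimitiveOn Gᶜ S ↔ PrimitiveOn G S :=
  ⟨fun h => by simpa using h.compl, PrimitiveOn.compl⟩

theorem PrimitiveOn.homogeneous_or_twinOn {X : Set V} (hX : PrimitiveOn G X) {v : V} (hv : v ∉ X)
    (h : ¬ PrimitiveOn G (insert v X)) :
    Homogeneous G X v ∨ ∃ u ∈ X, TwinOn G X u v := by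
  simp only [PrimitiveOn, not_forall, not_or] at h
  obtain ⟨M, hM, hsub, hne⟩ := h
  rcases hX.inter_cases (Set.subset_insert v X) hM with h | ⟨u, hu, huM, h⟩ | h
  · refine absurd (fun a ha b hb => ?_) hsub
    rcases hM.1 ha with rfl | ha' <;> rcases hM.1 hb with rfl | hb' <;> grind
  · right
    have hvM : v ∈ M := by
      by_contra hvM
      refine hsub fun a ha b hb => ?_
      rcases hM.1 ha with rfl | ha' <;> rcases hM.1 hb with rfl | hb' <;> grind
    refine ⟨u, hu, fun z hz hzu => ?_⟩
    have hzM : z ∉ M := fun hzM => hzu (h z hz hzM)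
    exact ⟨hM.2 z (.inr hz) hzM u huM v hvM, hM.2 z (.inr hz) hzM v hvM u huM⟩
  · left
    have hvM : v ∉ M := fun hvM =>
      hne (hM.1.antisymm (Set.insert_subset hvM h))
    exact fun z hz w hw => hM.2 v (.inl rfl) hvM z (h z hz) w (h w hw)

theorem not_homogeneous_and_twinOn {X : Set V} (hX : PrimitiveOn G X) (h4 : 4 ≤ X.ncard)
    {u v : V} (hu : u ∈ X) (hh : Homogeneous G X v) (ht : TwinOn G X u v) : False := by
  have hfin : X.Finite := Set.finite_of_ncard_pos (by omega)
  have hcard := Set.ncard_sdiff_singleton_add_one hu hfin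
  have hmod : IsModuleOn G X (X \ {u}) := by
    refine ⟨Set.sdiff_subset, fun z hz hzM a ha b hb => ?_⟩
    have hzu : z = u := by by_contra hne; exact hzM ⟨hz, hne⟩
    subst hzu
    have := ht a ha.1 ha.2
    have := ht b hb.1 hb.2
    have := hh a ha.1 b hb.1
    simp only [G.adj_comm z, G.adj_comm v] at *
    tauto
  rcases hX _ hmod with h | h
  · have := (Set.ncard_le_one (hfin.subset Set.sdiff_subset)).2 (fun a ha b hb => h ha hb)
    omega
  · rw [h] at hcard; omega

theorem TwinOn.unique {X : Set V} (hX : PrimitiveOn G X) (h4 : 4 ≤ X.ncard)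
    {u w v : V} (hu : u ∈ X) (hw : w ∈ X) (htu : TwinOn G X u v) (htw : TwinOn G X w v) :
    u = w := by
  by_contra hne
  have hmod : IsModuleOn G X {u, w} := by
    refine ⟨by grind, fun z hz hzM a ha b hb => ?_⟩
    have := htu z hz (by grind)
    have := htw z hz (by grind)
    grind
  rcases hX _ hmod with h | h
  · exact hne (h (by simp) (by simp))
  · have := Set.ncard_pair hne
    rw [h] at this; omega

theorem not_primitiveOn_pair_cases {X : Set V} (hX : PrimitiveOn G X) {x y : V}
    (h : ¬ PrimitiveOn G (insert x (insert y X))) :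
    (∀ z ∈ X, G.Adj z x ↔ G.Adj z y) ∨
    (∃ u ∈ X, TwinOn G X u x ∧ (G.Adj y u ↔ G.Adj y x)) ∨
    (∃ u ∈ X, TwinOn G X u y ∧ (G.Adj x u ↔ G.Adj x y)) ∨
    (∃ u ∈ X, TwinOn G X u x ∧ TwinOn G X u y) ∨
    (Homogeneous G X x ∧ Homogeneous G X y) ∨
    (Homogeneous G X y ∧ ∀ z ∈ X, G.Adj y z ↔ G.Adj y x) ∨
    (Homogeneous G X x ∧ ∀ z ∈ X, G.Adj x z ↔ G.Adj x y) := by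
  simp only [PrimitiveOn, not_forall, not_or] at h
  obtain ⟨M, hM, hsub, hne⟩ := h
  have hXS : X ⊆ insert x (insert y X) := fun z hz => .inr (.inr hz)
  have hxS : x ∈ insert x (insert y X) := by simp
  have hyS : y ∈ insert x (insert y X) := by simp
  have key : ∀ z ∈ insert x (insert y X), z ∉ M → ∀ a ∈ M, ∀ b ∈ M,
      (G.Adj z a ↔ G.Adj z b) := fun z hz hzM a ha b hb =>
    ⟨hM.2 z hz hzM a ha b hb, hM.2 z hz hzM b hb a ha⟩
  have mem : ∀ a ∈ M, a = x ∨ a = y ∨ a ∈ X := fun a ha => hM.1 ha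
  rcases hX.inter_cases hXS hM with h | ⟨u, hu, huM, h⟩ | h
  · left
    have hxM : x ∈ M := by
      by_contra hxM
      exact hsub fun a ha b hb => by grind
    have hyM : y ∈ M := by
      by_contra hyM
      exact hsub fun a ha b hb => by grind
    exact fun z hz => key z (hXS hz) (h z hz) x hxM y hyM
  · have htw : ∀ v ∈ M, TwinOn G X u v := fun v hv z hz hzu =>
      key z (hXS hz) (fun hzM => hzu (h z hz hzM)) u huM v hv
    by_cases hxM : x ∈ M <;> by_cases hyM : y ∈ M
    · exact .inr (.inr (.inr (.inl ⟨u, hu, htw x hxM, htw y hyM⟩)))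
    · exact .inr (.inl ⟨u, hu, htw x hxM, key y hyS hyM u huM x hxM⟩)
    · exact .inr (.inr (.inl ⟨u, hu, htw y hyM, key x hxS hxM u huM y hyM⟩))
    · exact absurd (fun a ha b hb => by grind) hsub
  · have hhom : ∀ v ∈ insert x (insert y X), v ∉ M → Homogeneous G X v :=
      fun v hv hvM z hz w hw => hM.2 v hv hvM z (h z hz) w (h w hw)
    by_cases hxM : x ∈ M <;> by_cases hyM : y ∈ M
    · exact absurd (hM.1.antisymm (Set.insert_subset hxM (Set.insert_subset hyM h))) hne
    · exact .inr (.inr (.inr (.inr (.inr (.inl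
        ⟨hhom y hyS hyM, fun z hz => key y hyS hyM z (h z hz) x hxM⟩)))))
    · exact .inr (.inr (.inr (.inr (.inr (.inr
        ⟨hhom x hxS hxM, fun z hz => key x hxS hxM z (h z hz) y hyM⟩)))))
    · exact .inr (.inr (.inr (.inr (.inl ⟨hhom x hxS hxM, hhom y hyS hyM⟩))))

/-- Ehrenfeucht and Rozenberg: a primitive induced subgraph missing at least two vertices
extends to a primitive induced subgraph with two more vertices. -/
theorem exists_primitiveOn_insert_insert {X : Set V} (hG : PrimitiveOn G Set.univ)
    (hX : PrimitiveOn G X) (h4 : 4 ≤ X.ncard) (h2 : ¬ Xᶜ.Subsingleton) :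
    ∃ x y, x ∉ X ∧ y ∉ X ∧ x ≠ y ∧ PrimitiveOn G (insert x (insert y X)) := by
  by_contra! hcon
  have hXne : ∀ u, ∃ w ∈ X, w ≠ u := by
    intro u
    by_contra! hall
    have := Set.ncard_le_ncard (show X ⊆ {u} from fun z hz => hall z hz)
    rw [Set.ncard_singleton] at this
    omega
  have hXcompl : ∃ v, v ∉ X := by
    by_contra! hall
    exact h2 fun a ha => absurd (hall a) ha
  have hdisj := fun u v (hu : u ∈ X) => @not_homogeneous_and_twinOn V G X hX h4 u v hu
  have huniq := fun u w v (hu : u ∈ X) (hw : w ∈ X) =>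
    @TwinOn.unique V G X hX h4 u w v hu hw
  have hno_hom : ∀ x ∉ X, ¬ Homogeneous G X x := by
    intro x hx hhx
    have hmod : IsModuleOn G Set.univ {v | v ∈ X ∨ ¬ Homogeneous G X v} := by
      refine ⟨Set.subset_univ _, fun z _ hz => ?_⟩
      simp only [Set.mem_ofPred_eq, not_or, not_not] at hz
      have key : ∀ y ∉ X, ¬ Homogeneous G X y → ∀ w ∈ X, (G.Adj z w ↔ G.Adj z y) := by
        intro y hy hyh w hw
        have hzy : z ≠ y := fun e => hyh (e ▸ hz.2)
        rcases not_primitiveOn_pair_cases hX (hcon z y hz.1 hy hzy) with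
          h | ⟨u, hu, ht, h⟩ | ⟨u, hu, ht, h⟩ | ⟨u, hu, ht, -⟩ | ⟨-, h⟩ | ⟨h, -⟩ | ⟨-, h⟩
        · refine absurd (fun a ha b hb => ?_) hyh
          have := h a ha
          have := h b hb
          have := hz.2 a ha b hb
          simp only [G.adj_comm z, G.adj_comm y] at *
          tauto
        · exact (hdisj u z hu hz.2 ht).elim
        · rw [← h]
          exact ⟨hz.2 w hw u hu, hz.2 u hu w hw⟩
        · exact (hdisj u z hu hz.2 ht).elim
        · exact absurd h hyh
        · exact absurd h hyh
        · exact h w hw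
      obtain ⟨w, hw, -⟩ := hXne x
      have key' : ∀ a, (a ∈ X ∨ ¬ Homogeneous G X a) → (G.Adj z a ↔ G.Adj z w) := by
        intro a ha
        by_cases haX : a ∈ X
        · exact ⟨hz.2 a haX w hw, hz.2 w hw a haX⟩
        · exact (key a haX (ha.resolve_left haX) w hw).symm
      exact fun a ha b hb hab => (key' b hb).2 ((key' a ha).1 hab)
    rcases hG _ hmod with h | h
    · obtain ⟨w, hw, -⟩ := hXne x
      obtain ⟨w', hw', hne⟩ := hXne w
      exact hne (h (.inl hw') (.inl hw))
    · have : x ∈ {v | v ∈ X ∨ ¬ Homogeneous G X v} := h ▸ Set.mem_univ x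
      grind
  have hno_twin : ∀ u ∈ X, ∀ x ∉ X, ¬ TwinOn G X u x := by
    intro u hu x hx htx
    have hmod : IsModuleOn G Set.univ {v | v = u ∨ (v ∉ X ∧ TwinOn G X u v)} := by
      refine ⟨Set.subset_univ _, fun y _ hy => ?_⟩
      simp only [Set.mem_ofPred_eq, not_or, not_and] at hy
      have key : ∀ a ∉ X, TwinOn G X u a → (G.Adj y a ↔ G.Adj y u) := by
        intro a ha hta
        by_cases hyX : y ∈ X
        · exact (hta y hyX hy.1).symm
        have hyt := hy.2 hyX
        have hay : a ≠ y := fun e => hyt (e ▸ hta)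
        rcases not_primitiveOn_pair_cases hX (hcon a y ha hyX hay) with
          h | ⟨w, hw, ht, h⟩ | ⟨w, hw, ht, h⟩ | ⟨w, hw, ht, ht'⟩ | ⟨h, -⟩ | ⟨-, h⟩ | ⟨h, -⟩
        · exact absurd (fun z hz hzu => (hta z hz hzu).trans (h z hz)) hyt
        · obtain rfl := huniq w u a hw hu ht hta
          exact h.symm
        · have hwu : w ≠ u := fun e => hyt (e ▸ ht)
          have h1 := ht u hu hwu.symm
          have h2 := hta w hw hwu
          simp only [G.adj_comm] at *
          tauto
        · obtain rfl := huniq w u a hw hu ht hta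
          exact absurd ht' hyt
        · exact absurd h (hno_hom a ha)
        · exact (h u hu).symm
        · exact absurd h (hno_hom a ha)
      have key' : ∀ a, (a = u ∨ (a ∉ X ∧ TwinOn G X u a)) → (G.Adj y a ↔ G.Adj y u) := by
        rintro a (rfl | ha)
        · rfl
        · exact key a ha.1 ha.2
      exact fun a ha b hb hab => (key' b hb).2 ((key' a ha).1 hab)
    rcases hG _ hmod with h | h
    · exact hx (h (.inl rfl) (.inr ⟨hx, htx⟩) ▸ hu)
    · obtain ⟨w, hw, hwu⟩ := hXne u
      have : w ∈ {v | v = u ∨ (v ∉ X ∧ TwinOn G X u v)} := h ▸ Set.mem_univ w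
      grind
  have hmod : IsModuleOn G Set.univ Xᶜ := by
    refine ⟨Set.subset_univ _, fun z _ hz x hx y hy => ?_⟩
    rw [Set.notMem_compl_iff] at hz
    by_cases hxy : x = y
    · exact fun h => hxy ▸ h
    rcases not_primitiveOn_pair_cases hX (hcon x y hx hy hxy) with
      h | ⟨w, hw, ht, -⟩ | ⟨w, hw, ht, -⟩ | ⟨w, hw, ht, -⟩ | ⟨h, -⟩ | ⟨h, -⟩ | ⟨h, -⟩
    · exact (h z hz).1
    · exact absurd ht (hno_twin w hw x hx)
    · exact absurd ht (hno_twin w hw y hy)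
    · exact absurd ht (hno_twin w hw x hx)
    · exact absurd h (hno_hom x hx)
    · exact absurd h (hno_hom y hy)
    · exact absurd h (hno_hom x hx)
  rcases hG _ hmod with h | h
  · exact h2 h
  · obtain ⟨v, -⟩ := hXcompl
    obtain ⟨w, hw, -⟩ := hXne v
    exact (h ▸ Set.mem_univ w : w ∈ Xᶜ) hw

theorem ncard_insert_insert [Finite V] {X : Set V} {x y : V} (hx : x ∉ X) (hy : y ∉ X)
    (hxy : x ≠ y) : (insert x (insert y X)).ncard = X.ncard + 2 := by
  rw [Set.ncard_insert_of_notMem (by grind), Set.ncard_insert_of_notMem hy]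

theorem exists_primitiveOn_compl_subsingleton [Finite V] (hG : PrimitiveOn G Set.univ)
    {X : Set V} (hX : PrimitiveOn G X) (h4 : 4 ≤ X.ncard) :
    ∃ Y, PrimitiveOn G Y ∧ Yᶜ.Subsingleton ∧ 4 ≤ Y.ncard ∧ Y.ncard % 2 = X.ncard % 2 := by
  induction hn : Nat.card V - X.ncard using Nat.strong_induction_on generalizing X with
  | _ n ih =>
    by_cases h2 : Xᶜ.Subsingleton
    · exact ⟨X, hX, h2, h4, rfl⟩
    · obtain ⟨x, y, hx, hy, hxy, hP⟩ := exists_primitiveOn_insert_insert hG hX h4 h2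
      have hc := ncard_insert_insert hx hy hxy
      have hle := Set.ncard_le_card (insert x (insert y X))
      obtain ⟨Y, h⟩ := ih _ (by omega) hP (by omega) rfl
      exact ⟨Y, h.1, h.2.1, h.2.2.1, by omega⟩

theorem IsPrimitive.primitiveOn_univ (h : IsPrimitive G) : PrimitiveOn G Set.univ := by
  intro M hM
  have hmod : IsModule G M := by
    intro z hz
    by_cases he : ∃ x ∈ M, G.Adj z x
    · obtain ⟨x, hx, hzx⟩ := he
      exact .inl fun y hy => hM.2 z trivial hz x hx y hy hzx
    · exact .inr fun x hx hzx => he ⟨x, hx, hzx⟩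
  rcases h.2 M hmod with rfl | ⟨x, rfl⟩ | h
  · exact .inl Set.subsingleton_empty
  · exact .inl Set.subsingleton_singleton
  · exact .inr h

theorem PrimitiveOn.isPrimitive_induce {S : Set V} (h : PrimitiveOn G S) (h4 : 4 ≤ S.ncard) :
    IsPrimitive (G.induce S) := by
  refine ⟨by rwa [Nat.card_coe_set_eq], fun M hM => ?_⟩
  have hmod : IsModuleOn G S (Subtype.val '' M) := by
    refine ⟨by simp, ?_⟩
    rintro z hz hzM _ ⟨a, ha, rfl⟩ _ ⟨b, hb, rfl⟩ hab
    rcases hM ⟨z, hz⟩ (fun hm => hzM ⟨_, hm, rfl⟩) with h | h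
    · exact h b hb
    · exact absurd hab (h a ha)
  rcases h _ hmod with hs | hs
  · rw [Subtype.val_injective.subsingleton_image_iff] at hs
    rcases hs.eq_empty_or_singleton with h | h
    · exact .inl h
    · exact .inr (.inl h)
  · right; right
    rw [← Set.image_eq_image Subtype.val_injective, hs]
    simp

theorem IsCriticalPrimitive.ncard_mod_two [Finite V] (hcp : IsCriticalPrimitive G) {X : Set V}
    (hX : PrimitiveOn G X) (h4 : 4 ≤ X.ncard) : X.ncard % 2 = Nat.card V % 2 := by
  obtain ⟨Y, hY, hsub, hY4, hpar⟩ :=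
    exists_primitiveOn_compl_subsingleton hcp.1.primitiveOn_univ hX h4
  rcases hsub.eq_empty_or_singleton with h | ⟨x, h⟩
  · rw [Set.compl_empty_iff] at h
    rw [← hpar, h, Set.ncard_univ]
  · rw [compl_eq_comm] at h
    subst h
    exact absurd (hY.isPrimitive_induce hY4) (hcp.2 x)

theorem IsInducedP4.primitiveOn {p q r s : V} (h : IsInducedP4 G p q r s) :
    PrimitiveOn G {p, q, r, s} := by
  obtain ⟨h1, h2, h3, h4, h5, h6⟩ := h
  intro M hM
  have key := hM.2
  simp only [Set.mem_insert_iff, Set.mem_singleton_iff, forall_eq_or_imp, forall_eq] at key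
  have mem : ∀ a ∈ M, a = p ∨ a = q ∨ a = r ∨ a = s := fun a ha => by simpa using hM.1 ha
  obtain ⟨kp, kq, kr, ks⟩ := key
  have e1 := h1.symm
  have e2 := h2.symm
  have e3 := h3.symm
  rw [G.adj_comm] at h4 h5 h6
  have h4' := h4
  have h5' := h5
  have h6' := h6
  rw [G.adj_comm] at h4' h5' h6'
  by_cases hall : p ∈ M ∧ q ∈ M ∧ r ∈ M ∧ s ∈ M
  · right
    ext a
    simp only [Set.mem_insert_iff, Set.mem_singleton_iff]
    grind
  · left
    intro a ha b hb
    have := mem a ha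
    have := mem b hb
    by_contra hab
    clear hM mem
    grind

theorem IsInducedP4.ncard {p q r s : V} (h : IsInducedP4 G p q r s) :
    ({p, q, r, s} : Set V).ncard = 4 := by
  obtain ⟨h1, h2, h3, h4, h5, h6⟩ := h
  have := h1.ne
  have := h2.ne
  have := h3.ne
  have hpr : p ≠ r := by rintro rfl; exact h5 h3
  have hps : p ≠ s := by rintro rfl; exact h4 h3.symm
  have hqs : q ≠ s := by rintro rfl; exact h5 h1
  rw [Set.ncard_insert_of_notMem (by grind), Set.ncard_insert_of_notMem (by grind),
    Set.ncard_pair (by grind)]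

theorem IsInducedP4.compl {p q r s : V} (h : IsInducedP4 G p q r s) :
    IsInducedP4 Gᶜ r p s q := by
  obtain ⟨h1, h2, h3, h4, h5, h6⟩ := h
  have hpr : p ≠ r := by rintro rfl; exact h5 h3
  have hps : p ≠ s := by rintro rfl; exact h4 h3.symm
  have hqs : q ≠ s := by rintro rfl; exact h5 h1
  simp only [IsInducedP4, SimpleGraph.compl_adj, G.adj_comm] at *
  grind [G.adj_comm]

theorem IsInducedP4.reverse {p q r s : V} (h : IsInducedP4 G p q r s) :
    IsInducedP4 G s r q p := by
  obtain ⟨h1, h2, h3, h4, h5, h6⟩ := h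
  exact ⟨h3.symm, h2.symm, h1.symm, fun h => h6 h.symm, fun h => h5 h.symm, fun h => h4 h.symm⟩

/-- Whether `S` splits into two nonempty parts with no edge of `G` between them. -/
def Separable (G : SimpleGraph V) (S : Set V) : Prop :=
  ∃ A B : Set V, A.Nonempty ∧ B.Nonempty ∧ A ∪ B = S ∧ ∀ a ∈ A, ∀ b ∈ B, a ≠ b ∧ ¬ G.Adj a b

theorem Separable.insert_or_compl {S : Set V} (hS : Separable G S) {v : V} (hv : v ∉ S)
    (hP : ∀ p q r s, ¬ IsInducedP4 G p q r s) :
    Separable G (insert v S) ∨ Separable Gᶜ (insert v S) := by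
  obtain ⟨A, B, hA, hB, rfl, hAB⟩ := hS
  by_contra! hcon
  obtain ⟨hcon, hcon'⟩ := hcon
  have part : ∀ A B : Set V, A.Nonempty → B.Nonempty → v ∉ A ∪ B →
      (∀ a ∈ A, ∀ b ∈ B, a ≠ b ∧ ¬ G.Adj a b) → ¬ Separable G (insert v (A ∪ B)) →
      ∀ a ∈ A, G.Adj v a := by
    intro A B hA hB hv hAB hcon a ha
    by_contra hva
    have hd : ∃ d ∈ B, G.Adj v d := by
      by_contra! hd
      exact hcon ⟨insert v A, B, ⟨v, by simp⟩, hB, by grind, by grind⟩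
    obtain ⟨d, hd, hvd⟩ := hd
    have hc : ∃ c ∈ A, ∃ c' ∈ A, G.Adj v c ∧ ¬ G.Adj v c' ∧ G.Adj c' c := by
      by_contra! hc
      refine hcon ⟨{x | x ∈ A ∧ ¬ G.Adj v x}, insert v (B ∪ {x | x ∈ A ∧ G.Adj v x}),
        ⟨a, ha, hva⟩, ⟨v, by simp⟩, ?_, ?_⟩
      · ext w
        simp only [Set.mem_union, Set.mem_insert_iff, Set.mem_ofPred_eq]
        tauto
      rintro x ⟨hx, hvx⟩ y (rfl | hy | ⟨hy, hvy⟩)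
      · exact ⟨by grind, fun h => hvx h.symm⟩
      · exact hAB x hx y hy
      · exact ⟨by grind, hc y hy x hx hvy hvx⟩
    obtain ⟨c, hc, c', hc', hvc, hvc', hcc⟩ := hc
    exact hP c' c v d ⟨hcc, hvc.symm, hvd, fun h => hvc' h.symm, (hAB c' hc' d hd).2,
      (hAB c hc d hd).2⟩
  have h1 := part A B hA hB hv hAB hcon
  have h2 := part B A hB hA (by grind)
    (fun b hb a ha => ⟨(hAB a ha b hb).1.symm, fun h => (hAB a ha b hb).2 h.symm⟩)
    (by rwa [Set.union_comm])
  refine hcon' ⟨{v}, A ∪ B, ⟨v, rfl⟩, hA.mono Set.subset_union_left, by grind, ?_⟩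
  rintro _ rfl b hb
  exact ⟨by grind, by grind [SimpleGraph.compl_adj]⟩

theorem separable_or_separable_compl (hP : ∀ p q r s, ¬ IsInducedP4 G p q r s)
    {S : Set V} (hS : S.Finite) (hn : ¬ S.Subsingleton) :
    Separable G S ∨ Separable Gᶜ S := by
  have hP' : ∀ p q r s, ¬ IsInducedP4 Gᶜ p q r s := fun p q r s h =>
    hP r p s q (by simpa using h.compl)
  induction S, hS using Set.Finite.induction_on with
  | empty => exact absurd Set.subsingleton_empty hn
  | @insert v S hv _ ih =>
    by_cases hs : S.Subsingleton
    · rcases hs.eq_empty_or_singleton with rfl | ⟨w, rfl⟩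
      · exact absurd (by simp) hn
      · have hvw : v ≠ w := hv
        by_cases ha : G.Adj v w
        · exact .inr ⟨{v}, {w}, ⟨v, rfl⟩, ⟨w, rfl⟩, rfl, by simp [hvw, ha]⟩
        · exact .inl ⟨{v}, {w}, ⟨v, rfl⟩, ⟨w, rfl⟩, rfl, by simp [hvw, ha]⟩
    · rcases ih hs with h | h
      · exact h.insert_or_compl hv hP
      · simpa [or_comm] using h.insert_or_compl hv hP'

theorem PrimitiveOn.not_separable [Finite V] {S : Set V} (h : PrimitiveOn G S)
    (h4 : 4 ≤ S.ncard) : ¬ Separable G S := by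
  rintro ⟨A, B, hA, hB, rfl, hAB⟩
  have hle := Set.ncard_union_le A B
  have part : ∀ A B : Set V, B.Nonempty → PrimitiveOn G (A ∪ B) →
      (∀ a ∈ A, ∀ b ∈ B, a ≠ b ∧ ¬ G.Adj a b) → A.ncard ≤ 1 := by
    intro A B hB h hAB
    have hmod : IsModuleOn G (A ∪ B) A := ⟨Set.subset_union_left, fun z hz hzA a ha b hb hza =>
      absurd hza.symm (hAB a ha z (hz.resolve_left hzA)).2⟩
    rcases h A hmod with h | h
    · exact Set.ncard_le_one_iff_subsingleton.2 h
    · obtain ⟨b, hb⟩ := hB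
      have : b ∈ A := h ▸ Set.mem_union_right A hb
      exact absurd rfl (hAB b this b hb).1
  have h1 := part A B hB h hAB
  have h2 := part B A hA (Set.union_comm A B ▸ h)
    (fun b hb a ha => ⟨(hAB a ha b hb).1.symm, fun h => (hAB a ha b hb).2 h.symm⟩)
  omega

theorem PrimitiveOn.exists_isInducedP4 [Finite V] {S : Set V} (h : PrimitiveOn G S)
    (h4 : 4 ≤ S.ncard) : ∃ p q r s, IsInducedP4 G p q r s := by
  by_contra! hP
  have hns : ¬ S.Subsingleton := fun hs => by
    have := Set.ncard_le_one_iff_subsingleton.2 hs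
    omega
  rcases separable_or_separable_compl hP S.toFinite hns with hs | hs
  · exact h.not_separable h4 hs
  · exact h.compl.not_separable h4 hs

/-- `G` contains the half graph `𝒢₃` as an induced subgraph. -/
def HasHalfGraph (G : SimpleGraph V) : Prop :=
  ∃ a₁ a₂ a₃ b₁ b₂ b₃ : V,
    (G.Adj a₁ b₁ ∧ G.Adj a₂ b₁ ∧ G.Adj a₂ b₂ ∧ G.Adj a₃ b₁ ∧ G.Adj a₃ b₂ ∧ G.Adj a₃ b₃) ∧
    (¬ G.Adj a₁ b₂ ∧ ¬ G.Adj a₁ b₃ ∧ ¬ G.Adj a₂ b₃) ∧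
    (¬ G.Adj a₁ a₂ ∧ ¬ G.Adj a₁ a₃ ∧ ¬ G.Adj a₂ a₃) ∧
    (¬ G.Adj b₁ b₂ ∧ ¬ G.Adj b₁ b₃ ∧ ¬ G.Adj b₂ b₃)

theorem calG_adj_inl_inr {n : ℕ} (i j : Fin n) :
    (calG n).Adj (Sum.inl i) (Sum.inr j) ↔ j ≤ i := by
  simp [calG]

theorem calG_not_adj_inl_inl {n : ℕ} (i j : Fin n) :
    ¬ (calG n).Adj (Sum.inl i) (Sum.inl j) := by
  simp [calG]

theorem calG_not_adj_inr_inr {n : ℕ} (i j : Fin n) :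
    ¬ (calG n).Adj (Sum.inr i) (Sum.inr j) := by
  simp [calG]

theorem injective_of_adj_iff_calG {n : ℕ} {f : Fin n ⊕ Fin n → V}
    (h : ∀ x y, G.Adj (f x) (f y) ↔ (calG n).Adj x y) : Function.Injective f := by
  intro x y hxy
  have key : ∀ z, (calG n).Adj x z ↔ (calG n).Adj y z := fun z => by
    rw [← h, ← h, hxy]
  rcases x with x | x <;> rcases y with y | y
  · have h1 := key (Sum.inr x)
    have h2 := key (Sum.inr y)
    simp only [calG_adj_inl_inr, le_refl, true_iff, iff_true] at h1 h2
    rw [le_antisymm h1 h2]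
  · have := (key (Sum.inr x)).1 ((calG_adj_inl_inr x x).2 le_rfl)
    exact (calG_not_adj_inr_inr _ _ this).elim
  · have := (key (Sum.inr y)).2 ((calG_adj_inl_inr y y).2 le_rfl)
    exact (calG_not_adj_inr_inr _ _ this).elim
  · have h1 := key (Sum.inl x)
    have h2 := key (Sum.inl y)
    simp only [(calG n).adj_comm (Sum.inr _), calG_adj_inl_inr, le_refl, true_iff,
      iff_true] at h1 h2
    rw [le_antisymm h2 h1]

theorem HasHalfGraph.nonempty_embedding (h : HasHalfGraph G) : Nonempty (calG 3 ↪g G) := by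
  obtain ⟨a₁, a₂, a₃, b₁, b₂, b₃, ⟨h1, h2, h3, h4, h5, h6⟩, ⟨n1, n2, n3⟩, ⟨n4, n5, n6⟩,
    ⟨n7, n8, n9⟩⟩ := h
  have hAB : ∀ i j : Fin 3, G.Adj (![a₁, a₂, a₃] i) (![b₁, b₂, b₃] j) ↔ j ≤ i := by
    intro i j
    fin_cases i <;> fin_cases j <;> simp [*]
  have hAA : ∀ i j : Fin 3, ¬ G.Adj (![a₁, a₂, a₃] i) (![a₁, a₂, a₃] j) := by
    intro i j
    fin_cases i <;> fin_cases j <;> simp [*, G.adj_comm a₂ a₁, G.adj_comm a₃]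
  have hBB : ∀ i j : Fin 3, ¬ G.Adj (![b₁, b₂, b₃] i) (![b₁, b₂, b₃] j) := by
    intro i j
    fin_cases i <;> fin_cases j <;> simp [*, G.adj_comm b₂ b₁, G.adj_comm b₃]
  have adj : ∀ x y, G.Adj (Sum.elim ![a₁, a₂, a₃] ![b₁, b₂, b₃] x)
      (Sum.elim ![a₁, a₂, a₃] ![b₁, b₂, b₃] y) ↔ (calG 3).Adj x y := by
    rintro (x | x) (y | y)
    · exact iff_of_false (hAA x y) (calG_not_adj_inl_inl x y)
    · exact (hAB x y).trans (calG_adj_inl_inr x y).symm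
    · rw [G.adj_comm, (calG 3).adj_comm]
      exact (hAB y x).trans (calG_adj_inl_inr y x).symm
    · exact iff_of_false (hBB x y) (calG_not_adj_inr_inr x y)
  exact ⟨⟨⟨_, injective_of_adj_iff_calG adj⟩, adj _ _⟩⟩

section PrimitivePair

variable [Finite V] {X : Set V} {x y u : V}

theorem PrimitiveOn.not_homogeneous_pair (h : PrimitiveOn G (insert x (insert y X)))
    (hx : x ∉ X) (h4 : 4 ≤ X.ncard) (hhx : Homogeneous G X x) : ¬ Homogeneous G X y := by
  intro hhy
  have hmod : IsModuleOn G (insert x (insert y X)) X := by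
    refine ⟨fun z hz => .inr (.inr hz), ?_⟩
    rintro z (rfl | rfl | hz) hzX a ha b hb
    · exact hhx a ha b hb
    · exact hhy a ha b hb
    · exact absurd hz hzX
  rcases h X hmod with h | h
  · have := Set.ncard_le_one_iff_subsingleton.2 h
    omega
  · exact hx (h ▸ Set.mem_insert _ _)

theorem PrimitiveOn.adj_iff_not_of_homogeneous (h : PrimitiveOn G (insert x (insert y X)))
    (hx : x ∉ X) (hxy : x ≠ y) (h4 : 4 ≤ X.ncard) (hhx : Homogeneous G X x) (hu : u ∈ X) :
    G.Adj x y ↔ ¬ G.Adj x u := by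
  by_contra hcon
  have hmod : IsModuleOn G (insert x (insert y X)) (insert y X) := by
    refine ⟨Set.subset_insert _ _, ?_⟩
    rintro z (rfl | hz) hzX a ha b hb
    · have key : ∀ a ∈ insert y X, (G.Adj z a ↔ G.Adj z u) := by
        rintro a (rfl | ha)
        · tauto
        · exact ⟨hhx a ha u hu, hhx u hu a ha⟩
      rw [key a ha, key b hb]
      exact id
    · exact absurd hz hzX
  rcases h _ hmod with h | h
  · have := Set.ncard_le_one_iff_subsingleton.2 (h.anti (Set.subset_insert y X))
    omega
  · have : x ∈ insert y X := h ▸ Set.mem_insert _ _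
    grind

theorem PrimitiveOn.not_twinOn_pair (h : PrimitiveOn G (insert x (insert y X)))
    (hxy : x ≠ y) (h4 : 4 ≤ X.ncard) (htx : TwinOn G X u x) : ¬ TwinOn G X u y := by
  intro hty
  have hmod : IsModuleOn G (insert x (insert y X)) (insert x (insert y (X ∩ {u}))) := by
    refine ⟨by grind, ?_⟩
    rintro z hz hzM a ha b hb
    have hzX : z ∈ X := by grind
    have hzu : z ≠ u := by grind
    have key : ∀ a ∈ insert x (insert y (X ∩ {u})), (G.Adj z a ↔ G.Adj z u) := by
      rintro a (rfl | rfl | ⟨-, rfl⟩)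
      · exact (htx z hzX hzu).symm
      · exact (hty z hzX hzu).symm
      · rfl
    rw [key a ha, key b hb]
    exact id
  rcases h _ hmod with h | h
  · exact hxy (h (by simp) (by simp))
  · have hsub : X ⊆ {x, y, u} := by
      intro z hz
      have : z ∈ insert x (insert y (X ∩ {u})) := h ▸ .inr (.inr hz)
      grind
    have := Set.ncard_le_ncard hsub
    have := Set.ncard_insert_le x {y, u}
    have := Set.ncard_insert_le y {u}
    have := Set.ncard_singleton u
    omega

end PrimitivePair

theorem PrimitiveOn.adj_iff_not_of_twinOn {X : Set V} {x y u w : V}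
    (h : PrimitiveOn G (insert x (insert y X)))
    (hx : x ∉ X) (hy : y ∉ X) (hxy : x ≠ y) (hu : u ∈ X) (huw : u ≠ w)
    (htx : TwinOn G X u x) (hty : TwinOn G X w y) :
    G.Adj x y ↔ ¬ G.Adj u w := by
  by_contra hcon
  have hyu := hty u hu huw
  have hmod : IsModuleOn G (insert x (insert y X)) {u, x} := by
    refine ⟨by grind, ?_⟩
    rintro z hz hzM a ha b hb
    have key : G.Adj z x ↔ G.Adj z u := by
      rcases hz with rfl | rfl | hz
      · simp at hzM
      · rw [G.adj_comm z x, G.adj_comm z u]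
        tauto
      · exact (htx z hz (by grind)).symm
    grind
  rcases h _ hmod with h | h
  · have hux : u = x := h (.inl rfl) (.inr rfl)
    exact hx (hux ▸ hu)
  · have hym : y ∈ ({u, x} : Set V) := h ▸ .inr (.inl rfl)
    grind

theorem Homogeneous.compl {X : Set V} {v : V} (h : Homogeneous G X v) (hv : v ∉ X) :
    Homogeneous Gᶜ X v := by
  intro z hz w hw
  have := h w hw z hz
  simp only [SimpleGraph.compl_adj]
  grind

theorem TwinOn.compl {X : Set V} {u v : V} (h : TwinOn G X u v) (hv : v ∉ X) :
    TwinOn Gᶜ X u v := by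
  intro z hz hzu
  have := h z hz hzu
  simp only [SimpleGraph.compl_adj]
  grind

/-- Every vertex outside an induced path on four vertices forms with it a set
that is not primitive. -/
def NoPrimitiveExtension (G : SimpleGraph V) : Prop :=
  ∀ p q r s v, IsInducedP4 G p q r s → v ∉ ({p, q, r, s} : Set V) →
    ¬ PrimitiveOn G (insert v {p, q, r, s})

theorem insert_four_compl (p q r s : V) : ({p, q, r, s} : Set V) = {r, p, s, q} := by
  grind

theorem NoPrimitiveExtension.compl (hN : NoPrimitiveExtension G) : NoPrimitiveExtension Gᶜ := by
  intro p q r s v hP hv hprim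
  rw [primitiveOn_compl, insert_four_compl] at hprim
  exact hN r p s q v (by simpa using hP.compl) (insert_four_compl p q r s ▸ hv) hprim

theorem NoPrimitiveExtension.homogeneous_or_twinOn (hN : NoPrimitiveExtension G) {p q r s v : V}
    (hP : IsInducedP4 G p q r s) (hv : v ∉ ({p, q, r, s} : Set V)) :
    Homogeneous G {p, q, r, s} v ∨ ∃ u ∈ ({p, q, r, s} : Set V), TwinOn G {p, q, r, s} u v :=
  hP.primitiveOn.homogeneous_or_twinOn hv (hN p q r s v hP hv)

theorem IsInducedP4.twinOn_iff {p q r s v : V} (hP : IsInducedP4 G p q r s) :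
    (TwinOn G {p, q, r, s} p v ↔ (G.Adj v q ∧ ¬ G.Adj v r ∧ ¬ G.Adj v s)) ∧
    (TwinOn G {p, q, r, s} q v ↔ (G.Adj v p ∧ G.Adj v r ∧ ¬ G.Adj v s)) := by
  have := hP.1.ne
  have := hP.2.1.ne
  have hpr : p ≠ r := by rintro rfl; exact hP.2.2.2.2.1 hP.2.2.1
  have hps : p ≠ s := by rintro rfl; exact hP.2.2.2.1 hP.2.2.1.symm
  have hqs : q ≠ s := by rintro rfl; exact hP.2.2.2.2.1 hP.1
  obtain ⟨h1, h2, h3, h4, h5, h6⟩ := hP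
  have hc := fun a b => G.adj_comm a b
  simp only [TwinOn, Set.mem_insert_iff, Set.mem_singleton_iff, forall_eq_or_imp, forall_eq]
  constructor <;> grind

theorem insert_four_reverse (p q r s : V) : ({p, q, r, s} : Set V) = {s, r, q, p} := by
  grind

theorem IsInducedP4.twinOn_iff' {p q r s v : V} (hP : IsInducedP4 G p q r s) :
    (TwinOn G {p, q, r, s} r v ↔ (¬ G.Adj v p ∧ G.Adj v q ∧ G.Adj v s)) ∧
    (TwinOn G {p, q, r, s} s v ↔ (¬ G.Adj v p ∧ ¬ G.Adj v q ∧ G.Adj v r)) := by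
  rw [insert_four_reverse, hP.reverse.twinOn_iff.1, hP.reverse.twinOn_iff.2]
  tauto

theorem NoPrimitiveExtension.adj_cases (hN : NoPrimitiveExtension G) {p q r s : V}
    (hP : IsInducedP4 G p q r s) (v : V) :
    (G.Adj v p ∧ G.Adj v q ∧ G.Adj v r ∧ G.Adj v s) ∨
    (¬ G.Adj v p ∧ ¬ G.Adj v q ∧ ¬ G.Adj v r ∧ ¬ G.Adj v s) ∨
    (G.Adj v q ∧ ¬ G.Adj v r ∧ ¬ G.Adj v s) ∨
    (G.Adj v p ∧ G.Adj v r ∧ ¬ G.Adj v s) ∨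
    (¬ G.Adj v p ∧ G.Adj v q ∧ G.Adj v s) ∨
    (¬ G.Adj v p ∧ ¬ G.Adj v q ∧ G.Adj v r) := by
  by_cases hv : v ∈ ({p, q, r, s} : Set V)
  · obtain ⟨h1, h2, h3, h4, h5, h6⟩ := hP
    rcases hv with rfl | rfl | rfl | rfl
    · exact .inr (.inr (.inl ⟨h1, h4, h5⟩))
    · exact .inr (.inr (.inr (.inl ⟨h1.symm, h2, h6⟩)))
    · exact .inr (.inr (.inr (.inr (.inl ⟨fun h => h4 h.symm, h2.symm, h3⟩))))
    · exact .inr (.inr (.inr (.inr (.inr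
        ⟨fun h => h5 h.symm, fun h => h6 h.symm, h3.symm⟩))))
  · rcases hN.homogeneous_or_twinOn hP hv with h | ⟨u, hu, h⟩
    · have hp : p ∈ ({p, q, r, s} : Set V) := by simp
      have hq : q ∈ ({p, q, r, s} : Set V) := by simp
      have hr : r ∈ ({p, q, r, s} : Set V) := by simp
      have hs : s ∈ ({p, q, r, s} : Set V) := by simp
      by_cases hvp : G.Adj v p
      · exact .inl ⟨hvp, h p hp q hq hvp, h p hp r hr hvp, h p hp s hs hvp⟩
      · exact .inr (.inl ⟨hvp, fun e => hvp (h q hq p hp e), fun e => hvp (h r hr p hp e),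
          fun e => hvp (h s hs p hp e)⟩)
    · rcases hu with rfl | rfl | rfl | rfl
      · exact .inr (.inr (.inl (hP.twinOn_iff.1.1 h)))
      · exact .inr (.inr (.inr (.inl (hP.twinOn_iff.2.1 h))))
      · exact .inr (.inr (.inr (.inr (.inl (hP.twinOn_iff'.1.1 h)))))
      · exact .inr (.inr (.inr (.inr (.inr (hP.twinOn_iff'.2.1 h)))))

theorem NoPrimitiveExtension.hasHalfGraph_of_isolated (hN : NoPrimitiveExtension G)
    {p q r s x y u : V} (hP : IsInducedP4 G p q r s)
    (hx : ∀ z ∈ ({p, q, r, s} : Set V), ¬ G.Adj x z) (hxy : G.Adj x y)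
    (hu : u ∈ ({p, q, r, s} : Set V)) (hy : TwinOn G {p, q, r, s} u y) : HasHalfGraph G := by
  wlog hu' : u = p ∨ u = q generalizing p q r s
  · rw [insert_four_reverse] at hx hu hy
    refine this hP.reverse hx hu hy ?_
    rcases hu with h | h | h | h <;> simp_all
  have hc := fun a b => G.adj_comm a b
  simp only [Set.mem_insert_iff, Set.mem_singleton_iff, forall_eq_or_imp, forall_eq] at hx
  have hP' := hP
  obtain ⟨h1, h2, h3, h4, h5, h6⟩ := hP'
  rcases hu' with rfl | rfl
  · rw [hP.twinOn_iff.1] at hy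
    have := hN.adj_cases (p := y) (q := q) (r := r) (s := s) ⟨hy.1, h2, h3, hy.2.1, hy.2.2, h6⟩ x
    tauto
  · rw [hP.twinOn_iff.2] at hy
    have hPu : IsInducedP4 G x y r s := ⟨hxy, hy.2.1, h3, hx.2.2.1, hx.2.2.2, hy.2.2⟩
    have := hN.adj_cases hPu u
    have hyu : ¬ G.Adj u y := by
      rw [G.adj_comm u x] at this
      tauto
    refine ⟨s, u, y, r, p, x, ?_⟩
    grind

theorem NoPrimitiveExtension.hasHalfGraph_of_twinOn_ends (hN : NoPrimitiveExtension G)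
    {p q r s x y : V} (hP : IsInducedP4 G p q r s) (hxy : G.Adj x y)
    (hx : TwinOn G {p, q, r, s} p x) (hy : TwinOn G {p, q, r, s} s y) :
    HasHalfGraph G := by
  rw [hP.twinOn_iff.1] at hx
  rw [hP.twinOn_iff'.2] at hy
  obtain ⟨h1, h2, h3, h4, h5, h6⟩ := hP
  have hc := fun a b => G.adj_comm a b
  have h7 := hN.adj_cases (p := p) (q := q) (r := r) (s := y) (by unfold IsInducedP4; grind) x
  have h8 := hN.adj_cases (p := x) (q := q) (r := r) (s := s) (by unfold IsInducedP4; grind) y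
  have hxp : ¬ G.Adj x p := by tauto
  have hys : ¬ G.Adj y s := by
    rw [G.adj_comm y x] at h8
    tauto
  refine ⟨s, y, q, r, x, p, ?_⟩
  grind

theorem NoPrimitiveExtension.hasHalfGraph_of_twinOn_adj (hN : NoPrimitiveExtension G)
    {p q r s x y : V} (hP : IsInducedP4 G p q r s) (hxy : ¬ G.Adj x y)
    (hx : TwinOn G {p, q, r, s} p x) (hy : TwinOn G {p, q, r, s} q y) :
    HasHalfGraph G := by
  rw [hP.twinOn_iff.1] at hx
  rw [hP.twinOn_iff.2] at hy
  obtain ⟨h1, h2, h3, h4, h5, h6⟩ := hP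
  have hc := fun a b => G.adj_comm a b
  have h7 := hN.adj_cases (p := p) (q := y) (r := r) (s := s) (by unfold IsInducedP4; grind) x
  have h8 := hN.adj_cases (p := x) (q := q) (r := r) (s := s) (by unfold IsInducedP4; grind) y
  have hxp : ¬ G.Adj x p := by tauto
  have hyq : ¬ G.Adj y q := by
    rw [G.adj_comm y x] at h8
    tauto
  refine ⟨s, y, q, r, p, x, ?_⟩
  grind

theorem NoPrimitiveExtension.hasHalfGraph_of_twinOn (hN : NoPrimitiveExtension G)
    {p q r s x y u w : V} (hP : IsInducedP4 G p q r s) (hx : x ∉ ({p, q, r, s} : Set V))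
    (hy : y ∉ ({p, q, r, s} : Set V)) (hxy : x ≠ y) (huw : u ≠ w)
    (hu : u ∈ ({p, q, r, s} : Set V)) (hw : w ∈ ({p, q, r, s} : Set V))
    (htx : TwinOn G {p, q, r, s} u x) (hty : TwinOn G {p, q, r, s} w y)
    (hadj : G.Adj x y ↔ ¬ G.Adj u w) : HasHalfGraph G ∨ HasHalfGraph Gᶜ := by
  have hPc := hP.compl
  have htxr := insert_four_reverse p q r s ▸ htx
  have htyr := insert_four_reverse p q r s ▸ hty
  have htxc := insert_four_compl p q r s ▸ htx.compl hx
  have htyc := insert_four_compl p q r s ▸ hty.compl hy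
  have htxcr := insert_four_reverse r p s q ▸ htxc
  have htycr := insert_four_reverse r p s q ▸ htyc
  have hyx := G.adj_comm y x
  have hcxy : Gᶜ.Adj x y ↔ ¬ G.Adj x y := by simp [hxy]
  have hcyx : Gᶜ.Adj y x ↔ ¬ G.Adj x y := by rw [Gᶜ.adj_comm, hcxy]
  have ends := @NoPrimitiveExtension.hasHalfGraph_of_twinOn_ends V G hN
  have endsc := @NoPrimitiveExtension.hasHalfGraph_of_twinOn_ends V Gᶜ hN.compl
  have adj := @NoPrimitiveExtension.hasHalfGraph_of_twinOn_adj V G hN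
  have adjc := @NoPrimitiveExtension.hasHalfGraph_of_twinOn_adj V Gᶜ hN.compl
  have hc := fun a b => G.adj_comm a b
  have hP' := hP
  obtain ⟨h1, h2, h3, h4, h5, h6⟩ := hP'
  wlog hord : (u = p) ∨ (u = q ∧ w ≠ p) ∨ (u = r ∧ w = s) generalizing x y u w
  · have := @this y x w u
    grind
  rcases hord with rfl | ⟨rfl, hwp⟩ | ⟨rfl, rfl⟩
  · rcases hw with rfl | rfl | rfl | rfl
    · exact absurd rfl huw
    · exact .inl (adj hP (by tauto) htx hty)
    · exact .inr (adjc hPc (by tauto) htyc htxc)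
    · exact .inl (ends hP (by tauto) htx hty)
  · rcases hw with rfl | rfl | rfl | rfl
    · exact absurd rfl hwp
    · exact absurd rfl huw
    · exact .inr (endsc hPc (by tauto) htyc htxc)
    · exact .inr (adjc hPc.reverse (by tauto) htxcr htycr)
  · exact .inl (adj hP.reverse (by tauto) htyr htxr)

theorem NoPrimitiveExtension.hasHalfGraph_of_homogeneous (hN : NoPrimitiveExtension G)
    {p q r s x y u : V} (hP : IsInducedP4 G p q r s)
    (hy : y ∉ ({p, q, r, s} : Set V)) (hxy : x ≠ y) (hu : u ∈ ({p, q, r, s} : Set V))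
    (hhx : Homogeneous G {p, q, r, s} x) (hty : TwinOn G {p, q, r, s} u y)
    (hadj : G.Adj x y ↔ ¬ G.Adj x u) : HasHalfGraph G ∨ HasHalfGraph Gᶜ := by
  by_cases hxu : G.Adj x u
  · have hnon : ∀ z ∈ ({p, q, r, s} : Set V), ¬ Gᶜ.Adj x z := fun z hz h =>
      (SimpleGraph.compl_adj G x z).1 h |>.2 (hhx u hu z hz hxu)
    have hty' := hty.compl hy
    rw [insert_four_compl] at hnon hu hty'
    exact .inr (hN.compl.hasHalfGraph_of_isolated hP.compl hnon
      (by simp [hxy, hadj, hxu]) hu hty')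
  · exact .inl (hN.hasHalfGraph_of_isolated hP (fun z hz h => hxu (hhx z hz u hu h))
      (hadj.2 hxu) hu hty)

theorem NoPrimitiveExtension.hasHalfGraph [Finite V] (hN : NoPrimitiveExtension G)
    {p q r s x y : V} (hP : IsInducedP4 G p q r s) (hx : x ∉ ({p, q, r, s} : Set V))
    (hy : y ∉ ({p, q, r, s} : Set V)) (hxy : x ≠ y)
    (h : PrimitiveOn G (insert x (insert y {p, q, r, s}))) :
    HasHalfGraph G ∨ HasHalfGraph Gᶜ := by
  have h4 := hP.ncard.ge
  have h' := Set.insert_comm x y _ ▸ h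
  rcases hN.homogeneous_or_twinOn hP hx with hhx | ⟨u, hu, htx⟩ <;>
    rcases hN.homogeneous_or_twinOn hP hy with hhy | ⟨w, hw, hty⟩
  · exact absurd hhy (h.not_homogeneous_pair hx h4 hhx)
  · exact hN.hasHalfGraph_of_homogeneous hP hy hxy hw hhx hty
      (h.adj_iff_not_of_homogeneous hx hxy h4 hhx hw)
  · exact hN.hasHalfGraph_of_homogeneous hP hx hxy.symm hu hhy htx
      (h'.adj_iff_not_of_homogeneous hy hxy.symm h4 hhy hu)
  · have huw : u ≠ w := by
      rintro rfl
      exact h.not_twinOn_pair hxy h4 htx hty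
    exact hN.hasHalfGraph_of_twinOn hP hx hy hxy huw hu hw htx hty
      (h.adj_iff_not_of_twinOn hx hy hxy hu huw htx hty)

end

/-- Every critical-primitive graph on at least six vertices contains an
induced subgraph isomorphic to `𝒢₃` or to the complement of `𝒢₃`. -/
theorem criticalPrimitive_contains_calG3 {V : Type} [Fintype V]
    (G : SimpleGraph V) (hcp : IsCriticalPrimitive G) (hcard : 6 ≤ Nat.card V) :
    Nonempty (calG 3 ↪g G) ∨ Nonempty ((calG 3)ᶜ ↪g G) := by
  have hG := hcp.1.primitiveOn_univ
  obtain ⟨p, q, r, s, hP⟩ := hG.exists_isInducedP4 (by rw [Set.ncard_univ]; omega)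
  have hX := hP.ncard
  have hpar := hcp.ncard_mod_two hP.primitiveOn hX.ge
  have hN : NoPrimitiveExtension G := by
    intro p' q' r' s' v hP' hv hprim
    have hc := Set.ncard_insert_of_notMem hv
    rw [hP'.ncard] at hc
    have := hcp.ncard_mod_two hprim (by omega)
    omega
  have hcompl : ¬ ({p, q, r, s} : Set V)ᶜ.Subsingleton := by
    rw [← Set.ncard_le_one_iff_subsingleton]
    have := Set.ncard_add_ncard_compl ({p, q, r, s} : Set V)
    omega
  obtain ⟨x, y, hx, hy, hxy, hprim⟩ :=
    exists_primitiveOn_insert_insert hG hP.primitiveOn hX.ge hcompl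
  rcases hN.hasHalfGraph hP hx hy hxy hprim with h | h
  · exact .inl h.nonempty_embedding
  · obtain ⟨f⟩ := h.nonempty_embedding
    exact .inr ⟨by simpa using SimpleGraph.Embedding.complEquiv f⟩
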